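/- For an idempotent ultrafilter U on ℕ₀ and a finite string σ = ⟨d₀, d₁, …, d_n⟩ of elements of ℕ₀, write ⊕_U(σ) = d₀U ⊕ d₁U ⊕ … ⊕ d_nU, with the convention that ⊕_U of the empty string is the principal ultrafilter at 0. Then for all finite strings σ, τ of elements of ℕ₀: if σ ≈ᵤ τ then ⊕_U(σ) = ⊕_U(τ) for every idempotent ultrafilter U on ℕ₀. -/

import Mathlib

open Ultrafilter Polynomial

/-- The pseudo-sum `U ⊕ V` of ultrafilters on `ℕ`:
`A ∈ U ⊕ V ↔ {n | {m | n + m ∈ A} ∈ V} ∈ U`. -/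
def pseudoSum (U V : Ultrafilter ℕ) : Ultrafilter ℕ :=
  U.bind fun n => V.map fun m => n + m

/-- The product `h U` of an ultrafilter on `ℕ` by a natural number:
`A ∈ h U ↔ {n | n * h ∈ A} ∈ U`. -/
def smulU (h : ℕ) (U : Ultrafilter ℕ) : Ultrafilter ℕ :=
  U.map fun n => n * h

/-- `U` is idempotent: non-principal and `U ⊕ U = U`. -/
def IsIdempotentUF (U : Ultrafilter ℕ) : Prop :=
  (∀ n : ℕ, U ≠ pure n) ∧ pseudoSum U U = U

/-- The linear combination `d₀ U ⊕ d₁ U ⊕ … ⊕ dₙ U` associated to the string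
`⟨d₀, …, dₙ⟩`; the empty string gives the principal ultrafilter at `0`. -/
def oplusU (U : Ultrafilter ℕ) : List ℕ → Ultrafilter ℕ
  | [] => pure 0
  | [d] => smulU d U
  | d :: l => pseudoSum (smulU d U) (oplusU U l)

/-- `u`-equivalence: the smallest equivalence relation on finite strings of
integers containing `ε ≈ᵤ ⟨0⟩`, `⟨a⟩ ≈ᵤ ⟨a,a⟩`, and coherent with concatenation. -/
inductive UEquiv : List ℤ → List ℤ → Prop where
  | nil_zero : UEquiv [] [0]
  | dup (a : ℤ) : UEquiv [a] [a, a]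
  | refl (l : List ℤ) : UEquiv l l
  | symm {l₁ l₂ : List ℤ} : UEquiv l₁ l₂ → UEquiv l₂ l₁
  | trans {l₁ l₂ l₃ : List ℤ} : UEquiv l₁ l₂ → UEquiv l₂ l₃ → UEquiv l₁ l₃
  | append {σ σ' τ τ' : List ℤ} : UEquiv σ σ' → UEquiv τ τ' →
      UEquiv (σ ++ τ) (σ' ++ τ')

theorem mem_pseudoSum {U V : Ultrafilter ℕ} {A : Set ℕ} :
    A ∈ pseudoSum U V ↔ {n | {m | n + m ∈ A} ∈ V} ∈ U :=
  Iff.rfl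

theorem mem_smulU {h : ℕ} {U : Ultrafilter ℕ} {A : Set ℕ} :
    A ∈ smulU h U ↔ {n | n * h ∈ A} ∈ U :=
  Iff.rfl

theorem pseudoSum_assoc (U V W : Ultrafilter ℕ) :
    pseudoSum (pseudoSum U V) W = pseudoSum U (pseudoSum V W) := by
  ext A
  simp only [mem_pseudoSum, Set.mem_ofPred_eq, add_assoc]

theorem pseudoSum_pure_zero (U : Ultrafilter ℕ) : pseudoSum U (pure 0) = U := by
  ext A
  simp [mem_pseudoSum, Ultrafilter.mem_pure]

theorem pure_zero_pseudoSum (U : Ultrafilter ℕ) : pseudoSum (pure 0) U = U := by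
  ext A
  simp [mem_pseudoSum, Ultrafilter.mem_pure]

theorem smulU_zero (U : Ultrafilter ℕ) : smulU 0 U = pure 0 := by
  ext A
  by_cases h : 0 ∈ A
  · simp only [mem_smulU, mul_zero, Ultrafilter.mem_pure, h]
    exact iff_of_true Filter.univ_mem trivial
  · simp [mem_smulU, Ultrafilter.mem_pure, h]

theorem smulU_pseudoSum (h : ℕ) (U V : Ultrafilter ℕ) :
    smulU h (pseudoSum U V) = pseudoSum (smulU h U) (smulU h V) := by
  ext A
  simp only [mem_pseudoSum, mem_smulU, Set.mem_ofPred_eq, add_mul]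

theorem oplusU_cons (U : Ultrafilter ℕ) (d : ℕ) (l : List ℕ) :
    oplusU U (d :: l) = pseudoSum (smulU d U) (oplusU U l) := by
  cases l with
  | nil => exact (pseudoSum_pure_zero _).symm
  | cons => rfl

theorem oplusU_append (U : Ultrafilter ℕ) (l l' : List ℕ) :
    oplusU U (l ++ l') = pseudoSum (oplusU U l) (oplusU U l') := by
  induction l with
  | nil => exact (pure_zero_pseudoSum _).symm
  | cons d l ih => rw [List.cons_append, oplusU_cons, oplusU_cons, ih, pseudoSum_assoc]

/-- Truncating negative entries to `0` makes `oplusU` an invariant of `u`-equivalence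
on strings of arbitrary integers. -/
theorem UEquiv.oplusU_map_toNat {U : Ultrafilter ℕ} (hU : pseudoSum U U = U) {l l' : List ℤ}
    (h : UEquiv l l') : oplusU U (l.map Int.toNat) = oplusU U (l'.map Int.toNat) := by
  induction h with
  | nil_zero => exact (smulU_zero U).symm
  | dup a =>
    change smulU a.toNat U = pseudoSum (smulU a.toNat U) (smulU a.toNat U)
    rw [← smulU_pseudoSum, hU]
  | refl => rfl
  | symm _ ih => exact ih.symm
  | trans _ _ ih₁ ih₂ => exact ih₁.trans ih₂
  | append _ _ ih₁ ih₂ => simp only [List.map_append, oplusU_append, ih₁, ih₂]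

/-- If `σ ≈ᵤ τ` then `⊕_U(σ) = ⊕_U(τ)` for every idempotent ultrafilter `U`. -/
theorem oplus_eq_of_uequiv (σ τ : List ℕ)
    (h : UEquiv (σ.map fun m => (m : ℤ)) (τ.map fun m => (m : ℤ))) :
    ∀ U : Ultrafilter ℕ, IsIdempotentUF U → oplusU U σ = oplusU U τ := by
  intro U hU
  have map_toNat (l : List ℕ) : (l.flatMap fun m : ℕ => [(m : ℤ)]).map Int.toNat = l := by
    induction l with
    | nil => rfl
    | cons d l ih => simp [List.flatMap_cons, ih]
  have key := h.oplusU_map_toNat hU.2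
  simp only [List.map_id'] at key
  change oplusU U ((σ.flatMap fun m : ℕ => [(m : ℤ)]).map Int.toNat) =
    oplusU U ((τ.flatMap fun m : ℕ => [(m : ℤ)]).map Int.toNat) at key
  rwa [map_toNat, map_toNat] at key
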